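/- Suppose -VUV = G_1⋯G_r where each G_i is a conjugate of U in SL(2,ℤ). Then r ≥ 9, and a finite sequence of Hurwitz moves transforms the sequence (G_1,…,G_r) into a sequence (V, U, V, D_4,…,D_r) with D_4⋯D_r = -Id (minus the 2×2 identity matrix). -/

import Mathlib

/-- `SL(2,ℤ)`, the group of 2×2 integer matrices of determinant 1. -/
abbrev SL2Z := Matrix.SpecialLinearGroup (Fin 2) ℤ

instance : Fact (Even (Fintype.card (Fin 2))) := ⟨by simp⟩

/-- The matrix `U = [[1,1],[0,1]]`. -/
def U : SL2Z := ⟨!![1, 1; 0, 1], by norm_num [Matrix.det_fin_two_of]⟩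

/-- The matrix `V = [[1,0],[-1,1]]`. -/
def V : SL2Z := ⟨!![1, 0; -1, 1], by norm_num [Matrix.det_fin_two_of]⟩

/-- A single Hurwitz move on a finite sequence of elements of a group: some consecutive
pair `(a, b)` is replaced by `(b, b⁻¹ * a * b)` or by `(a * b * a⁻¹, a)`. -/
def HurwitzMove {G : Type*} [Group G] (L L' : List G) : Prop :=
  ∃ (p : List G) (a b : G) (t : List G),
    L = p ++ a :: b :: t ∧
    (L' = p ++ b :: (b⁻¹ * a * b) :: t ∨ L' = p ++ (a * b * a⁻¹) :: a :: t)

/-- A finite sequence of Hurwitz moves. -/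
def HurwitzEquiv {G : Type*} [Group G] : List G → List G → Prop :=
  Relation.ReflTransGen HurwitzMove

section Hurwitz

variable {G : Type*} [Group G]

theorem HurwitzMove.append_left {L L' : List G} (q : List G) (h : HurwitzMove L L') :
    HurwitzMove (q ++ L) (q ++ L') := by
  obtain ⟨p, a, b, t, rfl, rfl | rfl⟩ := h
  · exact ⟨q ++ p, a, b, t, by simp, Or.inl (by simp)⟩
  · exact ⟨q ++ p, a, b, t, by simp, Or.inr (by simp)⟩

theorem HurwitzMove.append_right {L L' : List G} (q : List G) (h : HurwitzMove L L') :
    HurwitzMove (L ++ q) (L' ++ q) := by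
  obtain ⟨p, a, b, t, rfl, rfl | rfl⟩ := h
  · exact ⟨p, a, b, t ++ q, by simp, Or.inl (by simp)⟩
  · exact ⟨p, a, b, t ++ q, by simp, Or.inr (by simp)⟩

theorem HurwitzMove.prod_eq {L L' : List G} (h : HurwitzMove L L') : L'.prod = L.prod := by
  obtain ⟨p, a, b, t, rfl, rfl | rfl⟩ := h <;> simp [mul_assoc]

theorem HurwitzMove.length_eq {L L' : List G} (h : HurwitzMove L L') :
    L'.length = L.length := by
  obtain ⟨p, a, b, t, rfl, rfl | rfl⟩ := h <;> simp

theorem HurwitzEquiv.refl (L : List G) : HurwitzEquiv L L := Relation.ReflTransGen.refl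

theorem HurwitzEquiv.trans {L L' L'' : List G} (h : HurwitzEquiv L L')
    (h' : HurwitzEquiv L' L'') : HurwitzEquiv L L'' := Relation.ReflTransGen.trans h h'

theorem HurwitzEquiv.append_left {L L' : List G} (q : List G) (h : HurwitzEquiv L L') :
    HurwitzEquiv (q ++ L) (q ++ L') :=
  Relation.ReflTransGen.lift (q ++ ·) (fun _ _ => HurwitzMove.append_left q) _ _ h

theorem HurwitzEquiv.append_right {L L' : List G} (q : List G) (h : HurwitzEquiv L L') :
    HurwitzEquiv (L ++ q) (L' ++ q) :=
  Relation.ReflTransGen.lift (· ++ q) (fun _ _ => HurwitzMove.append_right q) _ _ h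

theorem HurwitzEquiv.prod_eq {L L' : List G} (h : HurwitzEquiv L L') : L'.prod = L.prod := by
  induction h with
  | refl => rfl
  | tail _ h ih => rw [h.prod_eq, ih]

theorem HurwitzEquiv.length_eq {L L' : List G} (h : HurwitzEquiv L L') :
    L'.length = L.length := by
  induction h with
  | refl => rfl
  | tail _ h ih => rw [h.length_eq, ih]

theorem HurwitzEquiv.move_right (a b : G) : HurwitzEquiv [a, b] [b, b⁻¹ * a * b] :=
  Relation.ReflTransGen.single ⟨[], a, b, [], rfl, Or.inl rfl⟩

theorem HurwitzEquiv.move_left (a b : G) : HurwitzEquiv [a, b] [a * b * a⁻¹, a] :=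
  Relation.ReflTransGen.single ⟨[], a, b, [], rfl, Or.inr rfl⟩

/-- A pair can be moved to the front, conjugating the elements it passes by its product. -/
theorem HurwitzEquiv.pair_to_front (p : List G) (a b : G) :
    HurwitzEquiv (p ++ [a, b]) ([a, b] ++ p.map fun x => (a * b)⁻¹ * x * (a * b)) := by
  induction p with
  | nil => exact .refl _
  | cons x p ih =>
    refine (ih.append_left [x]).trans ?_
    have h₁ := (HurwitzEquiv.move_right x a).append_right [b]
    have h₂ := (HurwitzEquiv.move_right (a⁻¹ * x * a) b).append_left [a]
    have h := (h₁.trans h₂).append_right (p.map fun x => (a * b)⁻¹ * x * (a * b))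
    simpa [mul_assoc] using h

/-- A pair can be moved to the back, conjugating the elements it passes by its product. -/
theorem HurwitzEquiv.pair_to_back (p : List G) (a b : G) :
    HurwitzEquiv ([a, b] ++ p) ((p.map fun x => (a * b) * x * (a * b)⁻¹) ++ [a, b]) := by
  induction p with
  | nil => exact .refl _
  | cons x p ih =>
    have h₁ := (HurwitzEquiv.move_left b x).append_left [a]
    have h₂ := (HurwitzEquiv.move_left a (b * x * b⁻¹)).append_right [b]
    have h := (h₁.trans h₂).append_right p
    have h₃ := ih.append_left [a * b * x * (a * b)⁻¹]
    simp only [List.map_cons, List.cons_append, List.nil_append, mul_inv_rev, mul_assoc]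
      at h h₃ ⊢
    exact h.trans h₃

end Hurwitz

namespace Modular

/-- The powers of the element `-VU` of order three. -/
def rot (i : ZMod 3) : SL2Z := (-(V * U)) ^ i.val

/-- The element `-VUV` of order four. -/
def flip : SL2Z := -(V * U * V)

theorem rot_zero : rot 0 = 1 := by decide

theorem rot_add (i j : ZMod 3) : rot (i + j) = rot i * rot j := by
  revert i j; decide

theorem rot_neg (i : ZMod 3) : rot (-i) = (rot i)⁻¹ := by
  revert i; decide

theorem flip_mul_flip : flip * flip = -1 := by decide

theorem flip_inv : flip⁻¹ = -flip := by decide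

/-- The trivalent tree dual to the Farey tessellation has a base vertex fixed by `rot`, and a
base edge inverted by `flip`. `Beyond g` says that `g` moves the base vertex to the other side
of the base edge. -/
def Beyond (g : SL2Z) : Prop :=
  0 ≤ g 0 0 * g 1 0 ∧ 0 ≤ g 0 1 * g 1 1 ∧ 0 ≤ (g 0 0 - g 0 1) * (g 1 0 - g 1 1)

theorem beyond_neg (g : SL2Z) : Beyond (-g) ↔ Beyond g := by
  simp only [Beyond, Matrix.SpecialLinearGroup.coe_neg, Matrix.neg_apply]
  ring_nf

theorem coe_flip : (flip : Matrix (Fin 2) (Fin 2) ℤ) = !![0, -1; 1, 0] := by decide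

theorem coe_rot_one : (rot 1 : Matrix (Fin 2) (Fin 2) ℤ) = !![-1, -1; 1, 0] := by decide

theorem coe_rot_two : (rot 2 : Matrix (Fin 2) (Fin 2) ℤ) = !![0, 1; -1, -1] := by decide

theorem det_eq (g : SL2Z) : g 0 0 * g 1 1 - g 0 1 * g 1 0 = 1 := by
  rw [← Matrix.det_fin_two]; exact g.2

theorem mul_nonneg_of_sub_eq_one {m n : ℤ} (h : m - n = 1) : 0 ≤ m * n := by
  obtain rfl : m = n + 1 := by omega
  rcases le_or_gt 0 n with hn | hn
  · positivity
  · nlinarith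

theorem beyond_flip_mul (g : SL2Z) : Beyond (flip * g) ↔ ¬ Beyond g := by
  have hd := det_eq g
  simp only [Beyond, Matrix.SpecialLinearGroup.coe_mul, coe_flip, Matrix.mul_apply,
    Fin.sum_univ_two, Matrix.of_apply, Matrix.cons_val', Matrix.cons_val_zero,
    Matrix.cons_val_one, Matrix.cons_val_fin_one]
  generalize g 0 0 = x at *
  generalize g 0 1 = y at *
  generalize g 1 0 = z at *
  generalize g 1 1 = w at *
  have h₁ : 0 ≤ (x * z) * (y * w) := by
    linarith [mul_nonneg_of_sub_eq_one hd, mul_comm (x * w) (y * z)]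
  have h₂ : 0 ≤ (x * z) * ((x - y) * (z - w)) := by
    have := mul_nonneg_of_sub_eq_one (m := (x - y) * z) (n := x * (z - w)) (by linarith)
    linarith
  have h₃ : 0 ≤ (y * w) * ((x - y) * (z - w)) := by
    have := mul_nonneg_of_sub_eq_one (m := (x - y) * w) (n := y * (z - w)) (by linarith)
    linarith
  have e₁ : (0 * x + -1 * z) * (1 * x + 0 * z) = -(x * z) := by ring
  have e₂ : (0 * y + -1 * w) * (1 * y + 0 * w) = -(y * w) := by ring
  have e₃ : (0 * x + -1 * z - (0 * y + -1 * w)) * (1 * x + 0 * z - (1 * y + 0 * w)) =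
    -((x - y) * (z - w)) := by ring
  rw [e₁, e₂, e₃]
  constructor
  · rintro ⟨a₁, a₂, a₃⟩ ⟨b₁, b₂, b₃⟩
    have c₁ : x * z = 0 := by omega
    have c₂ : y * w = 0 := by omega
    have c₃ : (x - y) * (z - w) = 0 := by omega
    have c₄ : x * w + y * z = 0 := by linarith
    omega
  · intro h
    by_contra h'
    have : (x * z < 0 ∨ y * w < 0 ∨ (x - y) * (z - w) < 0) ∧
        (0 < x * z ∨ 0 < y * w ∨ 0 < (x - y) * (z - w)) := by omega
    obtain ⟨a | a | a, b | b | b⟩ := this <;> first | omega | nlinarith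

theorem beyond_flip_inv_mul (g : SL2Z) : Beyond (flip⁻¹ * g) ↔ ¬ Beyond g := by
  rw [flip_inv, neg_mul, beyond_neg, beyond_flip_mul]

theorem not_beyond_rot (i : ZMod 3) : ¬ Beyond (rot i) := by
  unfold Beyond; revert i; decide

theorem not_beyond_rot_mul {g : SL2Z} (hg : Beyond g) {i : ZMod 3} (hi : i ≠ 0) :
    ¬ Beyond (rot i * g) := by
  have hd := det_eq g
  have : i = 1 ∨ i = 2 := by revert i; decide
  obtain ⟨h₁, h₂, -⟩ := hg
  rintro ⟨h₃, h₄, -⟩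
  rcases this with rfl | rfl
  · simp only [Matrix.SpecialLinearGroup.coe_mul, coe_rot_one, Matrix.mul_apply,
      Fin.sum_univ_two, Matrix.of_apply, Matrix.cons_val', Matrix.cons_val_zero,
      Matrix.cons_val_one, Matrix.cons_val_fin_one] at h₃ h₄
    have hx : g 0 0 = 0 := by nlinarith
    have hy : g 0 1 = 0 := by nlinarith
    simp [hx, hy] at hd
  · simp only [Matrix.SpecialLinearGroup.coe_mul, coe_rot_two, Matrix.mul_apply,
      Fin.sum_univ_two, Matrix.of_apply, Matrix.cons_val', Matrix.cons_val_zero,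
      Matrix.cons_val_one, Matrix.cons_val_fin_one] at h₃ h₄
    have hx : g 1 0 = 0 := by nlinarith
    have hy : g 1 1 = 0 := by nlinarith
    simp [hx, hy] at hd

theorem eq_of_beyond_rot {g : SL2Z} {i j : ZMod 3} (hi : Beyond (rot (-i) * g))
    (hj : Beyond (rot (-j) * g)) : i = j := by
  by_contra h
  refine not_beyond_rot_mul hi (i := i - j) (sub_ne_zero.2 h) ?_
  rwa [← mul_assoc, ← rot_add, show i - j + -i = -j by ring]

/-- The element of `SL(2,ℤ)` spelled by a path of turns in the tree. -/
def path (w : List (ZMod 3)) : SL2Z := (w.map fun i => rot i * flip).prod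

theorem path_nil : path [] = 1 := rfl

theorem path_cons (i : ZMod 3) (w : List (ZMod 3)) :
    path (i :: w) = rot i * flip * path w := by simp [path]

theorem path_append (u w : List (ZMod 3)) : path (u ++ w) = path u * path w := by simp [path]

/-- `g` moves the base vertex beyond the last edge of the path `l`. -/
def Past (l : List (ZMod 3)) (g : SL2Z) : Prop := ¬ Beyond ((path l)⁻¹ * g)

theorem past_neg (l : List (ZMod 3)) (g : SL2Z) : Past l (-g) ↔ Past l g := by
  simp [Past, beyond_neg]

theorem past_cons (i : ZMod 3) (l : List (ZMod 3)) (g : SL2Z) :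
    Past (i :: l) g ↔ Past l (flip⁻¹ * (rot (-i) * g)) := by
  simp [Past, path_cons, rot_neg, mul_assoc]

theorem Past.beyond {l : List (ZMod 3)} : ∀ {i : ZMod 3} {g : SL2Z}, Past (i :: l) g →
    (∀ k ∈ l, k ≠ 0) → Beyond (rot (-i) * g) := by
  induction l with
  | nil =>
    intro i g h _
    rw [past_cons, Past, path_nil, inv_one, one_mul, beyond_flip_inv_mul, not_not] at h
    exact h
  | cons k l ih =>
    intro i g h hl
    rw [past_cons] at h
    have hk := ih h fun j hj => hl j (List.mem_cons_of_mem _ hj)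
    have := not_beyond_rot_mul hk (hl k List.mem_cons_self)
    rwa [← mul_assoc, ← rot_add, add_neg_cancel, rot_zero, one_mul, beyond_flip_inv_mul,
      not_not] at this

theorem not_past_rot {l : List (ZMod 3)} (hl : l ≠ []) (h : ∀ k ∈ l.tail, k ≠ 0)
    (i : ZMod 3) : ¬ Past l (rot i) := by
  cases l with
  | nil => exact absurd rfl hl
  | cons j l =>
    intro hp
    have := hp.beyond h
    rw [← rot_add] at this
    exact not_beyond_rot _ this

theorem prefix_or_prefix {l : List (ZMod 3)} : ∀ {l' : List (ZMod 3)} {g : SL2Z},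
    (∀ k ∈ l.tail, k ≠ 0) → (∀ k ∈ l'.tail, k ≠ 0) → Past l g → Past l' g →
    l <+: l' ∨ l' <+: l := by
  induction l with
  | nil => intro l' g _ _ _ _; exact Or.inl List.nil_prefix
  | cons i l ih =>
    intro l' g hl hl' h₁ h₂
    cases l' with
    | nil => exact Or.inr List.nil_prefix
    | cons j l' =>
      obtain rfl := eq_of_beyond_rot (h₁.beyond hl) (h₂.beyond hl')
      rw [past_cons] at h₁ h₂
      simp only [List.prefix_cons_inj]
      exact ih (fun k hk => hl k (List.mem_of_mem_tail hk))
        (fun k hk => hl' k (List.mem_of_mem_tail hk)) h₁ h₂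

/-- A description of a complementary region of the tree: a path, and a final turn. -/
abbrev Region := List (ZMod 3) × ZMod 3

/-- The element of `SL(2,ℤ)` spelled by a region. -/
def frame (ρ : Region) : SL2Z := path ρ.1 * rot ρ.2

/-- The conjugate of `U` fixing a region. -/
def twist (ρ : Region) : SL2Z := frame ρ * (rot 1 * flip * rot 1) * (frame ρ)⁻¹

theorem twist_eq_conj {g : SL2Z} {ρ ρ' : Region}
    (h : frame ρ' = g * frame ρ ∨ frame ρ' = -(g * frame ρ)) :
    twist ρ' = g * twist ρ * g⁻¹ := by
  rcases h with h | h <;> simp [twist, h, mul_assoc]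

/-- The region `ρ` turned by `rot j`. -/
def turn (j : ZMod 3) : Region → Region
  | ([], k) => ([], j + k)
  | (i :: w, k) => ((j + i) :: w, k)

theorem frame_turn (j : ZMod 3) (ρ : Region) : frame (turn j ρ) = rot j * frame ρ := by
  obtain ⟨_ | ⟨i, w⟩, k⟩ := ρ
  · simp [turn, frame, path_nil, rot_add]
  · simp [turn, frame, path_cons, rot_add, mul_assoc]

theorem length_turn (j : ZMod 3) (ρ : Region) : (turn j ρ).1.length = ρ.1.length := by
  obtain ⟨_ | ⟨i, w⟩, k⟩ := ρ <;> simp [turn]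

theorem twist_turn (j : ZMod 3) (ρ : Region) :
    twist (turn j ρ) = rot j * twist ρ * (rot j)⁻¹ :=
  twist_eq_conj (Or.inl (frame_turn j ρ))

/-- The region `ρ` moved along the path `w`. -/
def follow (w : List (ZMod 3)) (ρ : Region) : Region := (w ++ ρ.1, ρ.2)

theorem frame_follow (w : List (ZMod 3)) (ρ : Region) :
    frame (follow w ρ) = path w * frame ρ := by
  simp [follow, frame, path_append, mul_assoc]

theorem length_follow (w : List (ZMod 3)) (ρ : Region) :
    (follow w ρ).1.length = w.length + ρ.1.length := by simp [follow]

/-- A region whose path does not backtrack and is a shortest path to the region. -/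
def Reduced (ρ : Region) : Prop := (∀ k ∈ ρ.1.tail, k ≠ 0) ∧ (ρ.1 ≠ [] → ρ.2 = 0)

theorem exists_shorter_of_not_reduced {ρ : Region} (h : ¬ Reduced ρ) :
    ∃ ρ' : Region, twist ρ' = twist ρ ∧ ρ'.1.length < ρ.1.length := by
  obtain ⟨w, k⟩ := ρ
  by_cases h₁ : ∀ k ∈ w.tail, k ≠ 0
  · have h₂ : w ≠ [] ∧ k ≠ 0 := by
      by_contra h'
      exact h ⟨h₁, fun hw => by_contra fun hk => h' ⟨hw, hk⟩⟩
    obtain ⟨hw, hk⟩ := h₂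
    obtain ⟨u, y, rfl⟩ := (List.eq_nil_or_concat' w).resolve_left hw
    obtain ⟨m, hm⟩ : ∃ m, twist ([], m) = twist ([0], k) := by
      clear h
      revert k; decide
    refine ⟨follow u (turn y ([], m)), ?_, ?_⟩
    · rw [twist_eq_conj (g := path u * rot y) (ρ := ([], m)), hm]
      · exact (twist_eq_conj (Or.inl (by
          simp [frame, path_append, path_cons, path_nil, rot_zero, mul_assoc]))).symm
      · left; rw [frame_follow, frame_turn, mul_assoc]
    · rw [length_follow, length_turn]; simp
  · push Not at h₁
    obtain ⟨_, h₀, rfl⟩ := h₁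
    cases w with
    | nil => simp at h₀
    | cons x t =>
      obtain ⟨u, v, huv⟩ := List.append_of_mem h₀
      obtain ⟨u', y, hu'⟩ := (List.eq_nil_or_concat' (x :: u)).resolve_left (by simp)
      have hw : x :: t = u' ++ y :: 0 :: v := by
        have : x :: t = (x :: u) ++ 0 :: v := by simpa using huv
        rw [this, hu']; simp
      refine ⟨follow u' (turn y (v, k)), ?_, ?_⟩
      · rw [twist_eq_conj (g := 1) (ρ := (x :: t, k))]
        · simp
        · right
          rw [frame_follow, frame_turn, hw]
          simp only [frame, path_append, path_cons, rot_zero, one_mul]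
          have : rot y * flip * (flip * path v) = -(rot y * path v) := by
            rw [mul_assoc, ← mul_assoc flip flip, flip_mul_flip]; simp
          rw [this]; simp [mul_assoc]
      · rw [length_follow, length_turn, hw]; simp

/-- `g` moves the base vertex past the edge where `twist ρ` leaves the region `ρ`. -/
def Attracted (ρ : Region) (g : SL2Z) : Prop := Past (ρ.1 ++ [ρ.2 + 1]) g

/-- `g` moves the base vertex past the edge where `(twist ρ)⁻¹` leaves the region `ρ`. -/
def Repelled (ρ : Region) (g : SL2Z) : Prop := Past (ρ.1 ++ [ρ.2 - 1]) g

theorem attracted_twist_mul {ρ : Region} {g : SL2Z} (h : ¬ Repelled ρ g) :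
    Attracted ρ (twist ρ * g) := by
  simp only [Repelled, Past, not_not] at h
  simp only [Attracted, Past]
  have e₁ : (path (ρ.1 ++ [ρ.2 - 1]))⁻¹ * g = flip⁻¹ * (rot 1 * ((frame ρ)⁻¹ * g)) := by
    simp [path_append, path_cons, path_nil, frame, sub_eq_add_neg, rot_add, rot_neg, mul_assoc]
  have e₂ : (path (ρ.1 ++ [ρ.2 + 1]))⁻¹ * (twist ρ * g) = rot 1 * ((frame ρ)⁻¹ * g) := by
    simp [path_append, path_cons, path_nil, twist, frame, rot_add, mul_assoc]
  rw [e₂]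
  rwa [e₁, beyond_flip_inv_mul] at h

theorem Reduced.tail_append {ρ : Region} (h : Reduced ρ) {i : ZMod 3} (hi : i ≠ 0) :
    ∀ k ∈ (ρ.1 ++ [ρ.2 + i]).tail, k ≠ 0 := by
  obtain ⟨w, k⟩ := ρ
  obtain ⟨h₁, h₂⟩ := h
  cases w with
  | nil => simp
  | cons j w =>
    obtain rfl : k = 0 := h₂ (by simp)
    intro k hk
    simp only [List.cons_append, List.tail_cons, List.mem_append, List.mem_singleton,
      zero_add] at hk
    rcases hk with hk | rfl
    · exact h₁ k hk
    · exact hi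

theorem Reduced.not_attracted_rot {ρ : Region} (h : Reduced ρ) (i : ZMod 3) :
    ¬ Attracted ρ (rot i) :=
  not_past_rot (by simp) (h.tail_append (by decide)) i

theorem Reduced.not_repelled_one {ρ : Region} (h : Reduced ρ) : ¬ Repelled ρ 1 := by
  rw [← rot_zero]
  refine not_past_rot (by simp) ?_ 0
  rw [sub_eq_add_neg]
  exact h.tail_append (by decide)

/-- Two regions at the base vertex whose twists have product `-(rot 1)`. -/
def Cancels (ρ σ : Region) : Prop := ρ.1 = [] ∧ σ.1 = [] ∧ ρ.2 - 1 = σ.2 + 1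

theorem exists_twist_eq_left {ρ : Region} {w δ : List (ZMod 3)} {i j l : ZMod 3}
    {g : SL2Z} (hρ : ρ = (w ++ i :: δ, l))
    (hg : path w * rot j = g * (path w * rot i * flip) ∨
      path w * rot j = -(g * (path w * rot i * flip))) :
    ∃ ρ' : Region, twist ρ' = g * twist ρ * g⁻¹ ∧ ρ'.1.length < ρ.1.length := by
  refine ⟨follow w (turn j (δ, l)), twist_eq_conj ?_, ?_⟩
  · have : frame ρ = path w * rot i * flip * frame (δ, l) := by
      simp [hρ, frame, path_append, path_cons, mul_assoc]
    rw [this, ← mul_assoc, frame_follow, frame_turn, ← mul_assoc, ← neg_mul]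
    exact hg.imp (congrArg (· * frame (δ, l))) (congrArg (· * frame (δ, l)))
  · rw [length_follow, length_turn, hρ]; simp

theorem path_mul_rot_add_one (ρ : Region) :
    path ρ.1 * rot (ρ.2 + 1) = -(twist ρ * (path ρ.1 * rot (ρ.2 - 1) * flip)) := by
  simp [twist, frame, sub_eq_add_neg, rot_add, rot_neg, mul_assoc, flip_mul_flip]

theorem path_mul_rot_sub_one (ρ : Region) :
    path ρ.1 * rot (ρ.2 - 1) = (twist ρ)⁻¹ * (path ρ.1 * rot (ρ.2 + 1) * flip) := by
  rw [path_mul_rot_add_one]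
  simp [mul_assoc, flip_mul_flip]

/-- Two reduced regions do not interfere, unless they cancel or one of the two Hurwitz moves
shortens one of them. -/
theorem cancels_or_exists_shorter {ρ σ : Region} (hρ : Reduced ρ) (hσ : Reduced σ) {g : SL2Z}
    (h₁ : Repelled ρ g) (h₂ : Attracted σ g) :
    Cancels ρ σ ∨
    (∃ σ' : Region, twist σ' = twist ρ * twist σ * (twist ρ)⁻¹ ∧
      σ'.1.length < σ.1.length) ∨
    (∃ ρ' : Region, twist ρ' = (twist σ)⁻¹ * twist ρ * twist σ ∧
      ρ'.1.length < ρ.1.length) := by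
  have hρ' : ∀ k ∈ (ρ.1 ++ [ρ.2 - 1]).tail, k ≠ 0 := by
    rw [sub_eq_add_neg]; exact hρ.tail_append (by decide)
  have key : ρ.1 ++ [ρ.2 - 1] = σ.1 ++ [σ.2 + 1] → Cancels ρ σ := by
    intro h
    obtain ⟨hw, hk⟩ := List.append_inj' h rfl
    have hk : ρ.2 - 1 = σ.2 + 1 := by simpa using hk
    by_cases h0 : ρ.1 = []
    · exact ⟨h0, hw ▸ h0, hk⟩
    · rw [hρ.2 h0, hσ.2 (hw ▸ h0)] at hk
      exact absurd hk (by decide)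
  rcases prefix_or_prefix hρ' (hσ.tail_append (by decide)) h₁ h₂ with ⟨γ, hγ⟩ | ⟨γ, hγ⟩
  · rcases List.eq_nil_or_concat' γ with rfl | ⟨δ, e, rfl⟩
    · exact Or.inl (key (by simpa using hγ))
    · right; left
      rw [← List.append_assoc] at hγ
      have hw := (List.append_inj' hγ rfl).1
      exact exists_twist_eq_left (δ := δ) (l := σ.2)
        (by rw [← List.singleton_append, ← List.append_assoc, hw]) (.inr (path_mul_rot_add_one ρ))
  · rcases List.eq_nil_or_concat' γ with rfl | ⟨δ, e, rfl⟩
    · exact Or.inl (key (by simpa using hγ.symm))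
    · right; right
      rw [← List.append_assoc] at hγ
      have hw := (List.append_inj' hγ rfl).1
      have := exists_twist_eq_left (δ := δ) (l := ρ.2)
        (by rw [← List.singleton_append, ← List.append_assoc, hw]) (.inl (path_mul_rot_sub_one σ))
      rwa [inv_inv] at this

/-- Multiplication by `twist ρ` keeps the base vertex moving away after `twist σ`. -/
def Transverse (ρ σ : Region) : Prop := ∀ g, Attracted σ g → ¬ Repelled ρ g

theorem attracted_prod {R : List Region} : ∀ {ρ : Region}, (∀ σ ∈ ρ :: R, Reduced σ) →
    List.IsChain Transverse (ρ :: R) → Attracted ρ ((ρ :: R).map twist).prod := by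
  induction R with
  | nil =>
    intro ρ h _
    rw [List.map_cons, List.prod_cons]
    exact attracted_twist_mul (h ρ (by simp)).not_repelled_one
  | cons σ R ih =>
    intro ρ h hc
    rw [List.isChain_cons_cons] at hc
    rw [List.map_cons, List.prod_cons]
    exact attracted_twist_mul
      (hc.1 _ (ih (fun τ hτ => h τ (List.mem_cons_of_mem _ hτ)) hc.2))

/-- `g` moves the base vertex to a neighbouring vertex, inverting an edge up to rotation. -/
def IsStep (g : SL2Z) : Prop := ∃ i, g = rot i * flip ∨ g = -(rot i * flip)

theorem eq_singleton_of_isStep {R : List Region} (h : ∀ σ ∈ R, Reduced σ)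
    (hc : List.IsChain Transverse R) (hs : IsStep (R.map twist).prod) :
    ∃ k, R = [([], k)] := by
  obtain ⟨i, hi⟩ := hs
  cases R with
  | nil =>
    exfalso
    simp only [List.map_nil, List.prod_nil] at hi
    revert i; decide
  | cons ρ R =>
    have hat := attracted_prod h hc
    have hρ := h ρ (by simp)
    have hat' : Attracted ρ (rot i * flip) := by
      rcases hi with hi | hi <;> rw [hi] at hat
      · exact hat
      · exact (past_neg _ _).1 hat
    have hpast : Past [i] (rot i * flip) := by
      simp only [Past, path_cons, path_nil, mul_one, inv_mul_cancel]
      rw [← rot_zero]; exact not_beyond_rot 0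
    have htail := hρ.tail_append (i := 1) (by decide)
    obtain ⟨w, k⟩ := ρ
    cases w with
    | cons j w =>
      exfalso
      have hp := prefix_or_prefix (by simp) htail hpast hat'
      obtain rfl : i = j := by
        rcases hp with hp | hp <;> simp at hp
        exact hp
      simp only [Attracted, List.cons_append, past_cons, rot_neg] at hat'
      simp only [inv_mul_cancel_left, inv_mul_cancel] at hat'
      rw [← rot_zero] at hat'
      exact not_past_rot (by simp) (fun k hk => htail k (List.mem_of_mem_tail hk)) 0 hat'
    | nil =>
      obtain rfl : i = k + 1 := by
        have hp := prefix_or_prefix (by simp) htail hpast hat'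
        rcases hp with hp | hp <;> simp at hp
        · exact hp
        · exact hp.symm
      cases R with
      | nil => exact ⟨k, rfl⟩
      | cons σ R =>
        exfalso
        have hσ := h σ (by simp)
        have hat₂ := attracted_prod (fun τ hτ => h τ (List.mem_cons_of_mem _ hτ)) hc.tail
        rw [List.map_cons, List.prod_cons] at hi
        set x := ((σ :: R).map twist).prod
        have hx : x = rot (k - 1) ∨ x = -rot (k - 1) := by
          have hk : rot (k - 1) = (twist ([], k))⁻¹ * (rot (k + 1) * flip) := by
            simpa [path_nil] using path_mul_rot_sub_one ([], k)
          rw [hk]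
          refine hi.imp (fun h => ?_) (fun h => ?_)
          · rw [← h, inv_mul_cancel_left]
          · rw [← mul_neg, ← h, inv_mul_cancel_left]
        rcases hx with hx | hx <;> rw [hx] at hat₂
        · exact hσ.not_attracted_rot _ hat₂
        · exact hσ.not_attracted_rot _ ((past_neg _ _).1 hat₂)

theorem Reduced.of_nil {ρ : Region} (h : ρ.1 = []) : Reduced ρ := by simp [Reduced, h]

theorem not_transverse {ρ σ : Region} (hρ : Reduced ρ) (hσ : Reduced σ)
    (h : ¬ Transverse ρ σ) : Cancels ρ σ ∨
    (∃ σ' : Region, twist σ' = twist ρ * twist σ * (twist ρ)⁻¹ ∧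
      σ'.1.length < σ.1.length) ∨
    (∃ ρ' : Region, twist ρ' = (twist σ)⁻¹ * twist ρ * twist σ ∧
      ρ'.1.length < ρ.1.length) := by
  unfold Transverse at h
  push Not at h
  obtain ⟨g, h₁, h₂⟩ := h
  exact cancels_or_exists_shorter hρ hσ h₂ h₁

theorem twist_eq_V : twist ([], 1) = V := by decide

theorem twist_eq_U : twist ([], 2) = U := by decide

theorem V_mul_U : V * U = -rot 1 := by decide

theorem twist_mul_twist (k : ZMod 3) : twist ([], k + 2) * twist ([], k) = V * U := by
  revert k; decide

/-- The cancelling pairs at the base vertex are Hurwitz equivalent. -/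
theorem hurwitzEquiv_pair (k m : ZMod 3) :
    HurwitzEquiv [twist ([], k + 2), twist ([], k)] [twist ([], m + 2), twist ([], m)] := by
  have next (k : ZMod 3) : HurwitzEquiv [twist ([], k + 2), twist ([], k)]
      [twist ([], k + 1 + 2), twist ([], k + 1)] := by
    have e : [twist ([], k + 1 + 2), twist ([], k + 1)] = [twist ([], k),
        (twist ([], k))⁻¹ * twist ([], k + 2) * twist ([], k)] := by
      revert k; decide
    rw [e]
    exact .move_right _ _
  have hm : m = k ∨ m = k + 1 ∨ m = k + 1 + 1 := by revert k m; decide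
  rcases hm with rfl | rfl | rfl
  · exact .refl _
  · exact next k
  · exact (next k).trans (next (k + 1))

/-- A cancelling pair can be moved to the front and normalized to `V, U`. -/
theorem hurwitzEquiv_of_cancels {ρ σ : Region} (h : Cancels ρ σ) (p t : List Region) :
    HurwitzEquiv ((p ++ ρ :: σ :: t).map twist)
      ([V, U] ++ (p.map (turn (-1)) ++ t).map twist) := by
  obtain ⟨w, k⟩ := ρ
  obtain ⟨w', k'⟩ := σ
  obtain ⟨rfl, rfl, hk⟩ : w = [] ∧ w' = [] ∧ k - 1 = k' + 1 := h
  obtain rfl : k = k' + 2 := by rw [sub_eq_iff_eq_add.1 hk]; ring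
  have h₁ := HurwitzEquiv.pair_to_front (p.map twist) (twist ([], k' + 2)) (twist ([], k'))
  have h₂ := ((hurwitzEquiv_pair k' 2).append_right ((p.map (turn (-1))).map twist))
  rw [show (2 : ZMod 3) + 2 = 1 by decide, twist_eq_U, twist_eq_V] at h₂
  have e : (p.map twist).map (fun x => (twist ([], k' + 2) * twist ([], k'))⁻¹ * x *
      (twist ([], k' + 2) * twist ([], k'))) = (p.map (turn (-1))).map twist := by
    rw [twist_mul_twist, V_mul_U, List.map_map, List.map_map]
    refine List.map_congr_left fun τ _ => ?_
    simp [twist_turn, rot_neg]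
  rw [e] at h₁
  simpa using (h₁.trans h₂).append_right (t.map twist)

/-- The total length of the paths of a list of regions. -/
def size (R : List Region) : ℕ := (R.map fun ρ => ρ.1.length).sum

theorem size_append (R R' : List Region) : size (R ++ R') = size R + size R' := by simp [size]

theorem size_cons (ρ : Region) (R : List Region) : size (ρ :: R) = ρ.1.length + size R := by
  simp [size]

theorem size_turn (j : ZMod 3) (R : List Region) : size (R.map (turn j)) = size R := by
  simp only [size, List.map_map, Function.comp_def, length_turn]

/-- If there is a cancelling pair at the base vertex and a region away from the base vertex,
then Hurwitz moves shorten the latter. -/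
theorem exists_smaller_of_mem {R : List Region} {ρ : Region} (hρ : ρ ∈ R) (h : ρ.1 ≠ []) :
    ∃ R', HurwitzEquiv ([V, U] ++ R.map twist) (R'.map twist) ∧ size R' < size R := by
  obtain ⟨q, t, rfl⟩ := List.append_of_mem hρ
  obtain ⟨w, l⟩ := ρ
  cases w with
  | nil => exact absurd rfl h
  | cons i δ =>
    obtain ⟨ρ', hρ', hlt⟩ := exists_twist_eq_left (ρ := (i :: δ, l)) (w := []) rfl
      (.inr (by simpa using path_mul_rot_add_one ([], i + 1)))
    refine ⟨q.map (turn 1) ++ ([], i + 1 + 2) :: ρ' :: ([], i + 1) :: t, ?_, ?_⟩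
    · have h₁ := HurwitzEquiv.pair_to_back (q.map twist) V U
      have e : (q.map twist).map (fun x => V * U * x * (V * U)⁻¹) =
          (q.map (turn 1)).map twist := by
        rw [V_mul_U, List.map_map, List.map_map]
        refine List.map_congr_left fun τ _ => ?_
        simp [twist_turn]
      rw [e] at h₁
      have h₂ := hurwitzEquiv_pair 2 (i + 1)
      rw [show (2 : ZMod 3) + 2 = 1 by decide, twist_eq_U, twist_eq_V] at h₂
      have h₃ := (h₁.trans (h₂.append_left _)).append_right (twist (i :: δ, l) :: t.map twist)
      have h₄ := ((HurwitzEquiv.move_left (twist ([], i + 1)) (twist (i :: δ, l))).append_left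
        ((q.map (turn 1)).map twist ++ [twist ([], i + 1 + 2)])).append_right (t.map twist)
      rw [← hρ'] at h₄
      have h₅ := h₃.trans (by simpa using h₄)
      simpa using h₅
    · simp only [size_append, size_cons, size_turn, List.length_nil] at *
      omega

/-- A factorization of a step can be moved to regions at the base vertex. -/
theorem exists_hurwitzEquiv_base (n : ℕ) : ∀ R : List Region, size R = n →
    IsStep (R.map twist).prod →
    ∃ R' : List Region, HurwitzEquiv (R.map twist) (R'.map twist) ∧ ∀ ρ ∈ R', ρ.1 = [] := by
  induction n using Nat.strong_induction_on with
  | _ n ih =>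
  rintro R rfl hs
  have descend {R' : List Region} (h : HurwitzEquiv (R.map twist) (R'.map twist))
      (hlt : size R' < size R) : ∃ R'' : List Region,
      HurwitzEquiv (R.map twist) (R''.map twist) ∧ ∀ ρ ∈ R'', ρ.1 = [] := by
    obtain ⟨R'', h', hR''⟩ := ih _ hlt R' rfl (h.prod_eq ▸ hs)
    exact ⟨R'', h.trans h', hR''⟩
  by_cases hred : ∀ σ ∈ R, Reduced σ
  swap
  · push Not at hred
    obtain ⟨σ, hσ, hn⟩ := hred
    obtain ⟨p, t, rfl⟩ := List.append_of_mem hσ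
    obtain ⟨σ', h, hlt⟩ := exists_shorter_of_not_reduced hn
    refine descend (R' := p ++ σ' :: t) ?_ (by simp only [size_append, size_cons]; omega)
    simp only [List.map_append, List.map_cons, h]
    exact .refl _
  by_cases hc : List.IsChain Transverse R
  · obtain ⟨k, rfl⟩ := eq_singleton_of_isStep hred hc hs
    exact ⟨_, .refl _, by simp⟩
  rw [List.isChain_iff_forall_rel_of_append_cons_cons] at hc
  push Not at hc
  obtain ⟨ρ, σ, p, t, rfl, hn⟩ := hc
  rcases not_transverse (hred ρ (by simp)) (hred σ (by simp)) hn with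
    h | ⟨σ', h, hlt⟩ | ⟨ρ', h, hlt⟩
  · by_cases hall : ∀ τ ∈ p.map (turn (-1)) ++ t, τ.1 = []
    · refine ⟨([], 1) :: ([], 2) :: (p.map (turn (-1)) ++ t), ?_, by simpa using hall⟩
      simpa [twist_eq_U, twist_eq_V] using hurwitzEquiv_of_cancels h p t
    · push Not at hall
      obtain ⟨τ, hτ, hne⟩ := hall
      obtain ⟨R', h', hlt⟩ := exists_smaller_of_mem hτ hne
      refine descend ((hurwitzEquiv_of_cancels h p t).trans h') (hlt.trans_le ?_)
      simp only [size_append, size_cons, size_turn]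
      omega
  · refine descend (R' := p ++ σ' :: ρ :: t) ?_ (by simp only [size_append, size_cons]; omega)
    simpa [h] using ((HurwitzEquiv.move_left (twist ρ) (twist σ)).append_left
      (p.map twist)).append_right (t.map twist)
  · refine descend (R' := p ++ σ :: ρ' :: t) ?_ (by simp only [size_append, size_cons]; omega)
    simpa [h] using ((HurwitzEquiv.move_right (twist ρ) (twist σ)).append_left
      (p.map twist)).append_right (t.map twist)

theorem IsStep.of_V_mul_U_mul {g : SL2Z} (h : IsStep (V * U * g)) : IsStep g := by
  obtain ⟨i, h⟩ := h
  have hg : g = -(rot (-1) * (V * U * g)) := by simp [V_mul_U, rot_neg]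
  refine ⟨-1 + i, ?_⟩
  rw [rot_add]
  rcases h with h | h <;> rw [h] at hg
  · right; rw [hg, mul_assoc]
  · left; rw [hg]; simp [mul_assoc]

/-- A factorization of a step into twists at the base vertex is equivalent to
`(V, U, V, U, …, V, U, X)`. -/
theorem exists_hurwitzEquiv_replicate (n : ℕ) : ∀ R : List Region, R.length = n →
    (∀ ρ ∈ R, ρ.1 = []) → IsStep (R.map twist).prod →
    ∃ m x, HurwitzEquiv (R.map twist)
      ((List.replicate m [V, U]).flatten ++ [twist ([], x)]) := by
  induction n using Nat.strong_induction_on with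
  | _ n ih =>
  rintro R rfl h₀ hs
  by_cases hc : List.IsChain Transverse R
  · obtain ⟨k, rfl⟩ := eq_singleton_of_isStep (fun ρ hρ => .of_nil (h₀ ρ hρ)) hc hs
    exact ⟨0, k, .refl _⟩
  rw [List.isChain_iff_forall_rel_of_append_cons_cons] at hc
  push Not at hc
  obtain ⟨ρ, σ, p, t, rfl, hn⟩ := hc
  have hρ := h₀ ρ (by simp)
  have hσ := h₀ σ (by simp)
  rcases not_transverse (.of_nil hρ) (.of_nil hσ) hn with h | ⟨σ', -, hlt⟩ | ⟨ρ', -, hlt⟩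
  · have hmove := hurwitzEquiv_of_cancels h p t
    obtain ⟨m, x, h'⟩ := ih _ (by simp) (p.map (turn (-1)) ++ t) rfl (by
        intro τ hτ
        rcases List.mem_append.1 hτ with hτ | hτ
        · obtain ⟨τ, hmem, rfl⟩ := List.mem_map.1 hτ
          rw [← List.length_eq_zero_iff, length_turn, h₀ τ (by simp [hmem]), List.length_nil]
        · exact h₀ τ (by simp [hτ])) (by
        apply IsStep.of_V_mul_U_mul
        rw [← hmove.prod_eq] at hs
        simpa [mul_assoc] using hs)
    refine ⟨m + 1, x, hmove.trans ?_⟩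
    simpa [List.replicate_succ] using h'.append_left [V, U]
  · simp [hσ] at hlt
  · simp [hρ] at hlt

theorem exists_twist_eq_conj (g : SL2Z) : ∀ ρ : Region,
    (∃ ρ' : Region, twist ρ' = g * twist ρ * g⁻¹) ∧
    (∃ ρ' : Region, twist ρ' = g⁻¹ * twist ρ * g) := by
  have hflip (ρ : Region) : twist (follow [0] ρ) = flip * twist ρ * flip⁻¹ :=
    twist_eq_conj (.inl (by simp [frame_follow, path_cons, path_nil, rot_zero]))
  have hg : g ∈ Subgroup.closure {ModularGroup.S, ModularGroup.T} := by
    rw [SpecialLinearGroup.SL2Z_generators]; trivial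
  induction hg using Subgroup.closure_induction with
  | mem x hx =>
    intro ρ
    rcases hx with rfl | rfl
    · rw [show ModularGroup.S = flip by decide]
      exact ⟨⟨_, hflip ρ⟩, ⟨follow [0] ρ, by rw [hflip, flip_inv]; simp⟩⟩
    · rw [show ModularGroup.T = flip * rot 2 by decide]
      refine ⟨⟨follow [0] (turn 2 ρ), by rw [hflip, twist_turn]; simp [mul_assoc]⟩,
        ⟨turn (-2) (follow [0] ρ), ?_⟩⟩
      rw [twist_turn, hflip, rot_neg, flip_inv, mul_inv_rev, flip_inv]
      simp [mul_assoc]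
  | one => exact fun ρ => ⟨⟨ρ, by simp⟩, ⟨ρ, by simp⟩⟩
  | mul x y _ _ hx hy =>
    intro ρ
    obtain ⟨ρ₁, h₁⟩ := (hy ρ).1
    obtain ⟨ρ₂, h₂⟩ := (hx ρ₁).1
    obtain ⟨ρ₃, h₃⟩ := (hx ρ).2
    obtain ⟨ρ₄, h₄⟩ := (hy ρ₃).2
    exact ⟨⟨ρ₂, by rw [h₂, h₁]; simp [mul_assoc]⟩, ⟨ρ₄, by rw [h₄, h₃]; simp [mul_assoc]⟩⟩
  | inv x _ hx => intro ρ; rw [inv_inv]; exact (hx ρ).symm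

theorem exists_twist_eq_of_isConj {A : SL2Z} (h : IsConj U A) : ∃ ρ, twist ρ = A := by
  obtain ⟨g, hg⟩ := isConj_iff.1 h
  obtain ⟨ρ, hρ⟩ := (exists_twist_eq_conj g ([], 2)).1
  exact ⟨ρ, by rw [hρ, twist_eq_U, hg]⟩

theorem exists_map_twist_eq {L : List SL2Z} (h : ∀ A ∈ L, IsConj U A) :
    ∃ R : List Region, R.map twist = L := by
  induction L with
  | nil => exact ⟨[], rfl⟩
  | cons A L ih =>
    obtain ⟨ρ, hρ⟩ := exists_twist_eq_of_isConj (h A (by simp))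
    obtain ⟨R, hR⟩ := ih fun B hB => h B (List.mem_cons_of_mem _ hB)
    exact ⟨ρ :: R, by simp [hρ, hR]⟩

theorem four_le_of_pow_mul_twist_eq {m : ℕ} {x : ZMod 3}
    (h : (V * U) ^ m * twist ([], x) = -(V * U * V)) : 4 ≤ m := by
  by_contra hm
  have : ∀ m < 4, ∀ x : ZMod 3, (V * U) ^ m * twist ([], x) ≠ -(V * U * V) := by decide
  exact this m (by omega) x h

end Modular

/-- Kodaira type III*: any factorization of `-VUV` into conjugates of `U` has `r ≥ 9` factors and Hurwitz moves bring it to `(V, U, V, D₄, …, Dᵣ)` with `D₄⋯Dᵣ = -1`. -/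
theorem normal_factorization_IIIstar (L : List SL2Z)
    (hconj : ∀ A ∈ L, IsConj U A)
    (hprod : L.prod = -(V * U * V)) :
    9 ≤ L.length ∧
    ∃ D : List SL2Z,
      HurwitzEquiv L ([V, U, V] ++ D) ∧ D.prod = -(1 : SL2Z) := by
  obtain ⟨R, rfl⟩ := Modular.exists_map_twist_eq hconj
  have hs : Modular.IsStep (R.map Modular.twist).prod :=
    ⟨0, .inl (by rw [hprod, Modular.rot_zero, one_mul, Modular.flip])⟩
  obtain ⟨R', h, h₀⟩ := Modular.exists_hurwitzEquiv_base _ R rfl hs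
  obtain ⟨m, x, h'⟩ := Modular.exists_hurwitzEquiv_replicate _ R' rfl h₀ (h.prod_eq ▸ hs)
  have H := h.trans h'
  have hm : 4 ≤ m := by
    refine Modular.four_le_of_pow_mul_twist_eq (x := x) ?_
    rw [← hprod, ← H.prod_eq]
    simp [List.prod_flatten]
  refine ⟨?_, ?_⟩
  · rw [← H.length_eq]
    simp
    omega
  · obtain ⟨m, rfl⟩ : ∃ k, m = k + 2 := ⟨m - 2, by omega⟩
    refine ⟨U :: ((List.replicate m [V, U]).flatten ++ [Modular.twist ([], x)]),
      by simpa [List.replicate_succ] using H, ?_⟩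
    have := H.prod_eq
    rw [hprod] at this
    refine mul_left_cancel (a := V * U * V) ?_
    simpa [List.replicate_succ, mul_assoc] using this
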